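/- Let q ≥ 2 and d ≥ 1 be integers and p a nonzero integer. The continuous loop S¹ → U(d)^q/ΔU(d) sending z to the coset of (z^p·I_d, I_d, …, I_d) is not nullhomotopic. -/

import Mathlib

/-- The diagonal subgroup `ΔU(d) = {(v, v, …, v) : v ∈ U(d)}` of the product group `U(d)^q`. -/
def diagonalUnitary (q d : ℕ) : Subgroup (Fin q → Matrix.unitaryGroup (Fin d) ℂ) where
  carrier := {u | ∃ v : Matrix.unitaryGroup (Fin d) ℂ, u = fun _ => v}
  one_mem' := ⟨1, rfl⟩
  mul_mem' := by
    rintro a b ⟨v, rfl⟩ ⟨w, rfl⟩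
    exact ⟨v * w, rfl⟩
  inv_mem' := by
    rintro a ⟨v, rfl⟩
    exact ⟨v⁻¹, rfl⟩

/-- The scalar unitary matrix `c·I_d ∈ U(d)`, for `c` on the unit circle. -/
def scalarUnitary (d : ℕ) (c : Circle) : Matrix.unitaryGroup (Fin d) ℂ :=
  ⟨(c : ℂ) • (1 : Matrix (Fin d) (Fin d) ℂ), by
    rw [Matrix.mem_unitaryGroup_iff, star_smul, star_one, Matrix.smul_mul, Matrix.mul_smul,
      one_mul, smul_smul]
    simp [Complex.mul_conj]⟩

lemma continuous_scalarUnitary (d : ℕ) : Continuous fun c : Circle => scalarUnitary d c := by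
  apply Continuous.subtype_mk
  have h1 : Continuous fun c : Circle => (c : ℂ) := continuous_subtype_val
  exact h1.smul continuous_const

/-- The determinant as a circle-valued map on the unitary group. -/
noncomputable def detCircle (d : ℕ) (u : Matrix.unitaryGroup (Fin d) ℂ) : Circle :=
  ⟨(u : Matrix (Fin d) (Fin d) ℂ).det, by
    have h := CStarRing.norm_of_mem_unitary (Matrix.det_of_mem_unitary u.2)
    exact mem_sphere_zero_iff_norm.2 h⟩

lemma detCircle_mul (d : ℕ) (u v : Matrix.unitaryGroup (Fin d) ℂ) :
    detCircle d (u * v) = detCircle d u * detCircle d v := by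
  apply Circle.ext
  rw [Circle.coe_mul]
  exact Matrix.det_mul _ _

lemma detCircle_one (d : ℕ) : detCircle d 1 = 1 := by
  apply Circle.ext
  simp [detCircle]

lemma detCircle_scalar (d : ℕ) (c : Circle) : detCircle d (scalarUnitary d c) = c ^ d := by
  apply Circle.ext
  simp [detCircle, scalarUnitary]

lemma continuous_detCircle (d : ℕ) : Continuous (detCircle d) := by
  apply Continuous.subtype_mk
  exact Continuous.matrix_det continuous_subtype_val

/-- The map `[u] ↦ det u₀ / det u₁` on the quotient. -/
noncomputable def detRatio (q d : ℕ) (hq : 2 ≤ q) :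
    C((Fin q → Matrix.unitaryGroup (Fin d) ℂ) ⧸ diagonalUnitary q d, Circle) where
  toFun := Quotient.lift
    (fun u => detCircle d (u ⟨0, by omega⟩) / detCircle d (u ⟨1, by omega⟩)) (by
      intro a b hab
      have h := QuotientGroup.leftRel_apply.1 hab
      obtain ⟨v, hv⟩ := h
      have hb : b = a * fun _ => v := by rw [← hv]; simp
      subst hb
      simp [detCircle_mul])
  continuous_toFun := by
    apply Continuous.quotient_lift
    have hc := continuous_detCircle d
    fun_prop

/-- A nonconstant power map of the circle is not nullhomotopic. -/
lemma circle_zpow_not_nullhomotopic (n : ℤ) (hn : n ≠ 0) (f : C(Circle, Circle))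
    (hf : ∀ z, f z = z ^ n) : ¬ f.Nullhomotopic := by
  rintro ⟨y, hy⟩
  obtain ⟨H⟩ := hy.symm
  have cov := Circle.isCoveringMap_exp
  obtain ⟨e, he⟩ := Circle.exp_surjective y
  have H0 : ∀ a, H.toContinuousMap (0, a) = Circle.exp ((ContinuousMap.const Circle e) a) := by
    intro a
    exact (H.apply_zero a).trans he.symm
  let L := cov.liftHomotopy H.toContinuousMap (ContinuousMap.const Circle e) H0
  have hL : ∀ z, Circle.exp (L (1, z)) = z ^ n := by
    intro z
    have h1 := congrFun (cov.liftHomotopy_lifts H.toContinuousMap (ContinuousMap.const Circle e) H0)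
      (1, z)
    exact h1.trans ((H.apply_one z).trans (hf z))
  have key : (fun t : ℝ => L (1, Circle.exp t)) = fun t : ℝ => n * t + L (1, 1) := by
    refine cov.eq_of_comp_eq (by fun_prop) (by fun_prop) ?_ 0 (by simp)
    funext t
    simp [hL, Circle.exp_add]
  have h2 := congrFun key (2 * Real.pi)
  simp [hn, Real.pi_ne_zero] at h2

/-- Let `q ≥ 2`, `d ≥ 1` and `p` a nonzero integer.  The continuous loop
`S¹ → U(d)^q/ΔU(d)` sending `z` to the coset of `(z^p·I_d, I_d, …, I_d)` is not
nullhomotopic. -/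
theorem zpow_loop_not_nullhomotopic_in_unitary_pow_mod_diagonal
    (q d : ℕ) (hq : 2 ≤ q) (hd : 1 ≤ d) (p : ℤ) (hp : p ≠ 0) :
    ¬ ContinuousMap.Nullhomotopic
      (⟨fun z : Circle =>
          (QuotientGroup.mk (fun i : Fin q => if i.val = 0 then scalarUnitary d (z ^ p) else 1)
            : (Fin q → Matrix.unitaryGroup (Fin d) ℂ) ⧸ diagonalUnitary q d),
        by
          apply QuotientGroup.continuous_mk.comp
          apply continuous_pi
          intro i
          by_cases h : i.val = 0
          · simpa [h, Function.comp_def] using (continuous_scalarUnitary d).comp (continuous_zpow p)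
          · simpa [h] using continuous_const⟩ : C(Circle,
          (Fin q → Matrix.unitaryGroup (Fin d) ℂ) ⧸ diagonalUnitary q d)) := by
  intro h
  have h' := h.comp_right (detRatio q d hq)
  refine circle_zpow_not_nullhomotopic (p * d) (mul_ne_zero hp (by omega)) _ ?_ h'
  intro z
  change detCircle d (if (0 : ℕ) = 0 then scalarUnitary d (z ^ p) else 1) /
    detCircle d (if (1 : ℕ) = 0 then scalarUnitary d (z ^ p) else 1) = _
  simp [detCircle_one, detCircle_scalar, zpow_mul]
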